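/- Let R be a commutative ring with 1, let N be its nilradical, let k ≥ 1, and let p : R^k → (R/N)^k be the map applying the quotient map R → R/N in each coordinate. Let M be a submodule of R^k and h ∈ R^k. Then h is integrally dependent on M if and only if p(h) is integrally dependent on the submodule p(M) of (R/N)^k. -/

import Mathlib

/-- `h` is integrally dependent on the ideal `I`: there is `k ≥ 1` and
`a j ∈ I ^ j` for `j = 1, …, k` with `h ^ k + ∑_{j=1}^k a j * h ^ (k - j) = 0`. -/
def IntegrallyDepOn {R : Type*} [CommRing R] (I : Ideal R) (h : R) : Prop :=
  ∃ k : ℕ, 0 < k ∧ ∃ a : ℕ → R, (∀ j ∈ Finset.Icc 1 k, a j ∈ I ^ j) ∧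
    h ^ k + ∑ j ∈ Finset.Icc 1 k, a j * h ^ (k - j) = 0

/-- The inclusion of `R^k` into its symmetric algebra, identified with the
polynomial ring `MvPolynomial (Fin k) R`: `h ↦ ∑ i, h i • X i`. -/
noncomputable def rho {R : Type*} [CommRing R] {k : ℕ} (h : Fin k → R) :
    MvPolynomial (Fin k) R :=
  ∑ i, MvPolynomial.C (h i) * MvPolynomial.X i

/-- `h ∈ R^k` is integrally dependent on a submodule `M ⊆ R^k` if `ρ(h)` is
integrally dependent on the ideal generated by `ρ(M)`. -/
def IntegrallyDepOnMod {R : Type*} [CommRing R] {k : ℕ}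
    (M : Submodule R (Fin k → R)) (h : Fin k → R) : Prop :=
  IntegrallyDepOn (Ideal.span (rho '' (M : Set (Fin k → R)))) (rho h)

open Polynomial in
theorem Polynomial.coeff_mul_mem_pow_sub {R : Type*} [CommRing R] {I : Ideal R} {p q : R[X]}
    {k l : ℕ} (hp : ∀ i, p.coeff i ∈ I ^ (k - i)) (hq : ∀ i, q.coeff i ∈ I ^ (l - i)) (i : ℕ) :
    (p * q).coeff i ∈ I ^ (k + l - i) := by
  rw [coeff_mul]
  refine Ideal.sum_mem _ fun x hx => ?_
  have hx' := Finset.HasAntidiagonal.mem_antidiagonal.mp hx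
  have h := Ideal.mul_mem_mul (hp x.1) (hq x.2)
  rw [← pow_add] at h
  exact Ideal.pow_le_pow_right (by omega) h

open Polynomial in
theorem Polynomial.coeff_pow_mem_pow_sub {R : Type*} [CommRing R] {I : Ideal R} {p : R[X]}
    {k : ℕ} (hp : ∀ i, p.coeff i ∈ I ^ (k - i)) (n i : ℕ) :
    (p ^ n).coeff i ∈ I ^ (n * k - i) := by
  induction n generalizing i with
  | zero => simp
  | succ n ih =>
    rw [pow_succ, Nat.succ_mul]
    exact coeff_mul_mem_pow_sub ih hp i

open Polynomial in
theorem integrallyDepOn_of_eval_eq_zero {R : Type*} [CommRing R] {I : Ideal R} {h : R} {k : ℕ}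
    (hk : 0 < k) {p : R[X]} (hdeg : p.natDegree ≤ k) (hlead : p.coeff k = 1)
    (hp : ∀ i, p.coeff i ∈ I ^ (k - i)) (heval : p.eval h = 0) : IntegrallyDepOn I h := by
  refine ⟨k, hk, fun j => p.coeff (k - j), fun j hj => ?_, ?_⟩
  · have := hp (k - j)
    rwa [Nat.sub_sub_self (Finset.mem_Icc.mp hj).2] at this
  · rw [eval_eq_sum_range' (Nat.lt_succ_of_le hdeg), ← Finset.sum_range_reflect,
      Finset.sum_range_succ'] at heval
    simp only [Nat.succ_eq_add_one, Nat.add_sub_cancel, Nat.sub_zero, hlead, one_mul] at heval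
    rw [← heval, add_comm, ← Finset.Ico_add_one_right_eq_Icc, Finset.sum_Ico_eq_sum_range,
      Nat.add_sub_cancel]
    simp only [add_comm 1]

open Polynomial in
theorem IntegrallyDepOn.of_isNilpotent {R : Type*} [CommRing R] {I : Ideal R} {h : R} {k : ℕ}
    (hk : 0 < k) {a : ℕ → R} (ha : ∀ j ∈ Finset.Icc 1 k, a j ∈ I ^ j)
    (hnil : IsNilpotent (h ^ k + ∑ j ∈ Finset.Icc 1 k, a j * h ^ (k - j))) :
    IntegrallyDepOn I h := by
  set p : R[X] := X ^ k + ∑ j ∈ Finset.Icc 1 k, C (a j) * X ^ (k - j) with hp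
  have hdeg : p.natDegree ≤ k := by
    refine natDegree_add_le_of_degree_le (natDegree_X_pow_le k) ?_
    exact natDegree_sum_le_of_forall_le _ _ fun j _ =>
      (natDegree_C_mul_X_pow_le _ _).trans (Nat.sub_le k j)
  have hlead : p.coeff k = 1 := by
    rw [hp, coeff_add, coeff_X_pow_self, finsetSum_coeff, Finset.sum_eq_zero, add_zero]
    intro j hj
    rw [Finset.mem_Icc] at hj
    rw [coeff_C_mul_X_pow, if_neg (by omega)]
  have hcoeff : ∀ i, p.coeff i ∈ I ^ (k - i) := by
    intro i
    rw [hp, coeff_add, finsetSum_coeff]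
    refine Ideal.add_mem _ ?_ (Ideal.sum_mem _ fun j hj => ?_)
    · rw [coeff_X_pow]
      split_ifs with hi
      · simp [hi]
      · exact Ideal.zero_mem _
    · rw [coeff_C_mul_X_pow]
      split_ifs with hi
      · have hjk := (Finset.mem_Icc.mp hj).2
        rw [hi, Nat.sub_sub_self hjk]
        exact ha j hj
      · exact Ideal.zero_mem _
  obtain ⟨n, hn⟩ := hnil
  refine integrallyDepOn_of_eval_eq_zero (k := (n + 1) * k) (p := p ^ (n + 1)) (by positivity)
    (natDegree_pow_le_of_le _ hdeg) ?_ (coeff_pow_mem_pow_sub hcoeff _) ?_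
  · rw [coeff_pow_of_natDegree_le hdeg, hlead, one_pow]
  · have heval : p.eval h = h ^ k + ∑ j ∈ Finset.Icc 1 k, a j * h ^ (k - j) := by
      simp [hp, eval_finsetSum]
    rw [eval_pow, heval, pow_succ, hn, zero_mul]

theorem IntegrallyDepOn.map {A B : Type*} [CommRing A] [CommRing B] (f : A →+* B) {I : Ideal A}
    {h : A} (H : IntegrallyDepOn I h) : IntegrallyDepOn (I.map f) (f h) := by
  obtain ⟨k, hk, a, ha, heq⟩ := H
  refine ⟨k, hk, fun j => f (a j), fun j hj => ?_, ?_⟩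
  · rw [← Ideal.map_pow]
    exact Ideal.mem_map_of_mem f (ha j hj)
  · simpa using congrArg f heq

theorem integrallyDepOn_map_iff {A B : Type*} [CommRing A] [CommRing B] {f : A →+* B}
    (hf : Function.Surjective f) (hker : ∀ x, f x = 0 → IsNilpotent x) {I : Ideal A} {h : A} :
    IntegrallyDepOn (I.map f) (f h) ↔ IntegrallyDepOn I h := by
  refine ⟨fun ⟨k, hk, b, hb, heq⟩ => ?_, IntegrallyDepOn.map f⟩
  have hlift : ∀ j, ∃ a, j ∈ Finset.Icc 1 k → a ∈ I ^ j ∧ f a = b j := by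
    intro j
    by_cases hj : j ∈ Finset.Icc 1 k
    · have hbj := hb j hj
      rw [← Ideal.map_pow, Ideal.mem_map_iff_of_surjective f hf] at hbj
      obtain ⟨a, ha⟩ := hbj
      exact ⟨a, fun _ => ha⟩
    · exact ⟨0, fun hj' => absurd hj' hj⟩
  choose a ha using hlift
  refine IntegrallyDepOn.of_isNilpotent hk (fun j hj => (ha j hj).1) (hker _ ?_)
  rw [← heq, map_add, map_pow, map_sum]
  congr 1
  exact Finset.sum_congr rfl fun j hj => by rw [map_mul, map_pow, (ha j hj).2]

theorem MvPolynomial.isNilpotent_of_map_mk_nilradical_eq_zero {R σ : Type*} [CommRing R]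
    {p : MvPolynomial σ R} (hp : map (Ideal.Quotient.mk (nilradical R)) p = 0) :
    IsNilpotent p := by
  rw [MvPolynomial.isNilpotent_iff]
  intro i
  have hi := congrArg (coeff i) hp
  rwa [coeff_map, coeff_zero, Ideal.Quotient.eq_zero_iff_mem, mem_nilradical] at hi

theorem map_rho {R S : Type*} [CommRing R] [CommRing S] (f : R →+* S) {k : ℕ} (v : Fin k → R) :
    MvPolynomial.map f (rho v) = rho fun i => f (v i) := by
  simp [rho]

theorem span_rho_image_span {R : Type*} [CommRing R] {k : ℕ} (s : Set (Fin k → R)) :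
    Ideal.span (rho '' (Submodule.span R s : Set (Fin k → R))) = Ideal.span (rho '' s) := by
  refine le_antisymm (Ideal.span_le.mpr ?_)
    (Ideal.span_mono (Set.image_mono Submodule.subset_span))
  rintro _ ⟨v, hv, rfl⟩
  induction hv using Submodule.span_induction with
  | mem v hv => exact Ideal.subset_span ⟨v, hv, rfl⟩
  | zero => simp [rho]
  | add v w _ _ hv hw =>
    have : rho (v + w) = rho v + rho w := by simp [rho, add_mul, Finset.sum_add_distrib]
    rw [this]
    exact Ideal.add_mem _ hv hw
  | smul c v _ hv =>
    have : rho (c • v) = MvPolynomial.C c * rho v := by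
      simp [rho, Finset.mul_sum, mul_assoc]
    rw [this]
    exact Ideal.mul_mem_left _ _ hv

/-- `h ∈ R^k` is integrally dependent on a submodule `M ⊆ R^k` iff its image
modulo the nilradical (taken coordinatewise) is integrally dependent on the
image submodule `p(M) ⊆ (R/N)^k`. -/
theorem integrallyDepOnMod_iff_quotient_nilradical {R : Type*} [CommRing R]
    (k : ℕ) (hk : 1 ≤ k) (M : Submodule R (Fin k → R)) (h : Fin k → R) :
    IntegrallyDepOnMod M h ↔
      IntegrallyDepOnMod
        (Submodule.span (R ⧸ nilradical R)
          ((fun v (i : Fin k) => Ideal.Quotient.mk (nilradical R) (v i)) ''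
            (M : Set (Fin k → R))))
        (fun i => Ideal.Quotient.mk (nilradical R) (h i)) := by
  have hideal : (Ideal.span (rho '' (M : Set (Fin k → R)))).map
      (MvPolynomial.map (Ideal.Quotient.mk (nilradical R))) =
      Ideal.span (rho '' ((fun v (i : Fin k) => Ideal.Quotient.mk (nilradical R) (v i)) ''
        (M : Set (Fin k → R)))) := by
    rw [Ideal.map_span, Set.image_image, Set.image_image]
    simp only [map_rho]
  rw [IntegrallyDepOnMod, IntegrallyDepOnMod, span_rho_image_span, ← hideal, ← map_rho]
  exact (integrallyDepOn_map_iff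
    (MvPolynomial.map_surjective _ Ideal.Quotient.mk_surjective)
    fun _ => MvPolynomial.isNilpotent_of_map_mk_nilradical_eq_zero).symm
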